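/- arXiv:2604.12131 — 6 statements merged into one kernel-verified Lean document; each statement's English description precedes it below -/
import Mathlib

section
/- One-sided lower-tail bound (Proposition 3.2): Let H be a homogeneous degree-k objective on {-1,1}^n that is not identically zero (so that, since H has mean zero over the cube, H_min < 0), let x* be an optimum assignment, and let η ∈ (0,1). Let q ∈ [0,1/2], let t ∈ {-1,1}^n have independent coordinates with P[t_i=-1]=q, set ρ = 1-2q, and X = x* ⊙ t. Then P[H(X) ≤ (1-η)·H_min] ≥ 1 - (1-ρ^k)/η. -/
open scoped Classical

noncomputable section

/-- The sign value of a Boolean coordinate: `true` encodes `-1`, `false` encodes `1`. -/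
def sgn (b : Bool) : ℝ := if b then -1 else 1

/-- The number of `-1` coordinates (i.e. `true` coordinates) of a point of the cube. -/
def wt {n : ℕ} (t : Fin n → Bool) : ℕ := (Finset.univ.filter fun i => t i = true).card

/-- A homogeneous degree-`k` objective `H(x) = ∑_{S ∈ 𝓕} c_S ∏_{i ∈ S} x_i` on `{-1,1}^n`,
with the cube encoded as `Fin n → Bool` via `sgn`. -/
def objH {n : ℕ} (F : Finset (Finset (Fin n))) (c : Finset (Fin n) → ℝ)
    (x : Fin n → Bool) : ℝ :=
  ∑ S ∈ F, c S * ∏ i ∈ S, sgn (x i)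

end

theorem weight_eq_prod {n : ℕ} (q : ℝ) (t : Fin n → Bool) :
    q ^ wt t * (1 - q) ^ (n - wt t) = ∏ i, if t i = true then q else 1 - q := by
  rw [Finset.prod_ite, Finset.prod_const, Finset.prod_const]
  have h := Finset.card_filter_add_card_filter_not (s := Finset.univ)
    (fun i : Fin n => t i = true)
  rw [Finset.card_univ, Fintype.card_fin] at h
  have hw : wt t = (Finset.univ.filter fun i => t i = true).card := rfl
  rw [hw]
  congr 2
  omega

theorem sgn_xor (a b : Bool) : sgn (xor a b) = sgn a * sgn b := by
  cases a <;> cases b <;> simp [sgn]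

theorem sum_weight_mul_prod_sgn {n : ℕ} (q : ℝ) (S : Finset (Fin n)) :
    ∑ t : Fin n → Bool, q ^ wt t * (1 - q) ^ (n - wt t) * ∏ i ∈ S, sgn (t i) =
      (1 - 2 * q) ^ S.card := by
  calc
    _ = ∑ t : Fin n → Bool, ∏ i,
          ((if t i = true then q else 1 - q) * if i ∈ S then sgn (t i) else 1) := by
        refine Finset.sum_congr rfl fun t _ => ?_
        rw [weight_eq_prod, Finset.prod_mul_distrib, Finset.prod_ite_mem, Finset.univ_inter]
    _ = ∏ i, ∑ b : Bool,
          ((if b = true then q else 1 - q) * if i ∈ S then sgn b else 1) := by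
        rw [Fintype.prod_sum fun (i : Fin n) (b : Bool) =>
          (if b = true then q else 1 - q) * if i ∈ S then sgn b else 1]
    _ = ∏ i, if i ∈ S then 1 - 2 * q else 1 := by
        refine Finset.prod_congr rfl fun i _ => ?_
        by_cases hi : i ∈ S <;> simp [hi, sgn]
        ring
    _ = _ := by
        rw [Finset.prod_ite_mem, Finset.univ_inter, Finset.prod_const]

theorem sum_weight {n : ℕ} (q : ℝ) :
    ∑ t : Fin n → Bool, q ^ wt t * (1 - q) ^ (n - wt t) = 1 := by
  simpa using sum_weight_mul_prod_sgn (n := n) q ∅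

theorem sum_weight_mul_objH {n k : ℕ} {F : Finset (Finset (Fin n))}
    (c : Finset (Fin n) → ℝ) (hF : ∀ S ∈ F, S.card = k) (x : Fin n → Bool) (q : ℝ) :
    ∑ t : Fin n → Bool,
        q ^ wt t * (1 - q) ^ (n - wt t) * objH F c (fun i => xor (x i) (t i)) =
      (1 - 2 * q) ^ k * objH F c x := by
  simp only [objH, sgn_xor, Finset.prod_mul_distrib, Finset.mul_sum]
  rw [Finset.sum_comm]
  refine Finset.sum_congr rfl fun S hS => ?_
  rw [← hF S hS, ← sum_weight_mul_prod_sgn q S, Finset.sum_mul]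
  refine Finset.sum_congr rfl fun t _ => ?_
  ring

theorem objH_optimum_neg {n k : ℕ} (hk : 1 ≤ k) {F : Finset (Finset (Fin n))}
    {c : Finset (Fin n) → ℝ} (hF : ∀ S ∈ F, S.card = k) (hne : ∃ x, objH F c x ≠ 0)
    {xstar : Fin n → Bool} (hopt : ∀ y, objH F c xstar ≤ objH F c y) :
    objH F c xstar < 0 := by
  by_contra! h
  obtain ⟨x, hx⟩ := hne
  have hmean := sum_weight_mul_objH c hF xstar (1 / 2)
  have hk0 : k ≠ 0 := by omega
  rw [show (1 - 2 * (1 / 2) : ℝ) = 0 by norm_num, zero_pow hk0, zero_mul,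
    Finset.sum_eq_zero_iff_of_nonneg
      fun t _ => mul_nonneg (by norm_num) (h.trans (hopt _))] at hmean
  have hzero := hmean (fun i => xor (xstar i) (x i)) (Finset.mem_univ _)
  simp only [← Bool.xor_assoc, Bool.xor_self, Bool.false_xor] at hzero
  rcases mul_eq_zero.mp hzero with h0 | h0
  · norm_num at h0
  · exact hx h0

/-- **One-sided lower-tail bound** (Proposition 3.2): if `H` is a homogeneous degree-`k`
objective that is not identically zero, `x*` an optimum assignment, `η ∈ (0,1)`,
`q ∈ [0,1/2]`, `ρ = 1 - 2q`, and `X = x* ⊙ t` with independent coordinate flips of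
probability `q`, then `P[H(X) ≤ (1-η)·H_min] ≥ 1 - (1 - ρ^k)/η`. The probability is
written as the explicit sum of the weights `q^{wt t} (1-q)^{n - wt t}` over the points
`t` for which `H(x* ⊙ t) ≤ (1-η)·H(x*)`. -/
theorem one_sided_lower_tail {n k : ℕ} (hn : 1 ≤ n) (hk : 1 ≤ k)
    (F : Finset (Finset (Fin n))) (c : Finset (Fin n) → ℝ)
    (hF : ∀ S ∈ F, S.card = k)
    (hne : ∃ x, objH F c x ≠ 0)
    (xstar : Fin n → Bool) (hopt : ∀ y, objH F c xstar ≤ objH F c y)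
    (η : ℝ) (hη0 : 0 < η) (hη1 : η < 1)
    (q : ℝ) (hq0 : 0 ≤ q) (hq1 : q ≤ 1 / 2) :
    1 - (1 - (1 - 2 * q) ^ k) / η ≤
      ∑ t ∈ Finset.univ.filter
          (fun t : Fin n → Bool =>
            objH F c (fun i => xor (xstar i) (t i)) ≤ (1 - η) * objH F c xstar),
        q ^ wt t * (1 - q) ^ (n - wt t) := by
  set w : (Fin n → Bool) → ℝ := fun t => q ^ wt t * (1 - q) ^ (n - wt t)
  set G : (Fin n → Bool) → ℝ := fun t => objH F c (fun i => xor (xstar i) (t i))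
  set m := objH F c xstar
  change _ ≤ ∑ t ∈ Finset.univ.filter (fun t => G t ≤ (1 - η) * m), w t
  have hneg : m < 0 := objH_optimum_neg hk hF hne hopt
  have hw0 : ∀ t, 0 ≤ w t := fun t =>
    mul_nonneg (pow_nonneg hq0 _) (pow_nonneg (by linarith) _)
  have hsum : ∑ t, w t = 1 := sum_weight q
  have hmean : ∑ t, w t * G t = (1 - 2 * q) ^ k * m := sum_weight_mul_objH c hF xstar q
  -- Markov inequality for the nonnegative variable `G - m`
  have hmarkov : ∑ t, w t * (m - η * m) - ∑ t, w t * G t ≤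
      ∑ t ∈ Finset.univ.filter (fun t => G t ≤ (1 - η) * m), w t * (-(η * m)) := by
    rw [Finset.sum_filter, ← Finset.sum_sub_distrib]
    refine Finset.sum_le_sum fun t _ => ?_
    split_ifs with h
    · nlinarith [mul_nonneg (hw0 t) (sub_nonneg.mpr (hopt fun i => xor (xstar i) (t i)))]
    · nlinarith [mul_nonneg (hw0 t) (sub_nonneg.mpr (not_le.mp h).le)]
  rw [← Finset.sum_mul, ← Finset.sum_mul, hsum, hmean] at hmarkov
  set P := ∑ t ∈ Finset.univ.filter (fun t => G t ≤ (1 - η) * m), w t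
  have hP : 1 - P ≤ (1 - (1 - 2 * q) ^ k) / η := by
    rw [le_div_iff₀ hη0]
    by_contra! hlt
    nlinarith [mul_neg_of_neg_of_pos hneg (sub_pos.mpr hlt)]
  linarith
end

section
/- Local-Lipschitz bound on light coordinates (Proposition 3.3): Consider a weighted MAX-k-CSP instance with objective H, optimum assignment x*, weighted degrees d_i, average weighted degree d_avg, worst-case Lipschitz factor Λ_max, and light set L_light. Then for every integer r ≥ 0 and every x ∈ B_{L_light}(x*, r) (the restricted Hamming ball around x* of radius r with all flipped coordinates in L_light), one has H(x) ≤ H_min + 2·Λ_max·d_avg·r. -/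
open scoped Classical

/-- Two centered contributions `-w` or `s * w / (D - s)` of a single constraint differ by at most
`D / (D - s) * w`. -/
theorem centered_contribution_le_add {D s w : ℝ} (hs : 0 ≤ s) (hsD : s < D) (hw : 0 ≤ w)
    (p q : Prop) [Decidable p] [Decidable q] :
    (if p then -w else s * w / (D - s)) ≤
      (if q then -w else s * w / (D - s)) + D / (D - s) * w := by
  have hpos : 0 < D - s := sub_pos.2 hsD
  have hgap : s * w / (D - s) = -w + D / (D - s) * w := by
    field_simp
    ring
  have hsw : 0 ≤ s * w / (D - s) := by positivity
  have hDw : 0 ≤ D / (D - s) * w := mul_nonneg (div_nonneg (hs.trans hsD.le) hpos.le) hw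
  split_ifs <;> linarith

/-- The total weight of the constraints meeting `F` is at most the sum of the weighted degrees
over `F`. -/
theorem sum_weight_touching_le_sum_degree {ι J : Type*} [Fintype J] (vars : J → Finset ι)
    (w : J → ℝ) (hw : ∀ j, 0 ≤ w j) (F : Finset ι) :
    ∑ j, (if ∃ i ∈ F, i ∈ vars j then w j else 0) ≤
      ∑ i ∈ F, ∑ j ∈ Finset.univ.filter (fun j => i ∈ vars j), w j := by
  simp_rw [Finset.sum_filter]
  rw [Finset.sum_comm]
  refine Finset.sum_le_sum fun j _ => ?_
  have hterm : ∀ i ∈ F, 0 ≤ if i ∈ vars j then w j else 0 := fun i _ => by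
    split_ifs <;> simp [hw j]
  split_ifs with h
  · obtain ⟨i, hiF, hij⟩ := h
    simpa [hij] using Finset.single_le_sum hterm hiF
  · exact Finset.sum_nonneg hterm

/-- **Local-Lipschitz bound on light coordinates** (Proposition 3.3): for a weighted
MAX-`k`-CSP instance with objective `H`, optimum assignment `x*`, weighted degrees `d_i`,
average weighted degree `d_avg`, worst-case Lipschitz factor `Λ_max`, and light set
`L_light = {i : d_i ≤ 2·d_avg}`, every point `x` of the restricted Hamming ball
`B_{L_light}(x*, r)` (all flipped coordinates light, at most `r` of them) satisfies
`H(x) ≤ H_min + 2·Λ_max·d_avg·r`.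

The cube `{-1,1}^n` is encoded as `Fin n → Bool`; constraints are indexed by a nonempty
finite type `J`; constraint `j` has variable set `vars j` of size `k_j ∈ [1,k]`, weight
`w j > 0`, and a predicate `sat j` depending only on the coordinates in `vars j`, with
exactly `s j · 2^{n - k_j}` satisfying assignments (i.e. `s j` satisfying local
assignments), where `1 ≤ s j ≤ 2^{k_j} - 1`. Its centered contribution is `-w j` on
satisfying assignments and `s_j·w_j/(2^{k_j}-s_j)` otherwise. -/
theorem local_lipschitz_light_coordinates {n k : ℕ} {J : Type*} [Fintype J] [Nonempty J]
    (hn : 0 < n)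
    (vars : J → Finset (Fin n)) (w : J → ℝ) (s : J → ℕ) (sat : J → (Fin n → Bool) → Bool)
    (hkj : ∀ j, 1 ≤ (vars j).card ∧ (vars j).card ≤ k)
    (hw : ∀ j, 0 < w j)
    (hs : ∀ j, 1 ≤ s j ∧ s j ≤ 2 ^ (vars j).card - 1)
    (hdep : ∀ j x y, (∀ i ∈ vars j, x i = y i) → sat j x = sat j y)
    (hcount : ∀ j, (Finset.univ.filter fun x : Fin n → Bool => sat j x = true).card
      = s j * 2 ^ (n - (vars j).card))
    (H : (Fin n → Bool) → ℝ)
    (hH : ∀ x, H x = ∑ j, if sat j x then -(w j)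
      else (s j : ℝ) * w j / ((2 : ℝ) ^ (vars j).card - (s j : ℝ)))
    (xstar : Fin n → Bool) (hopt : ∀ y, H xstar ≤ H y)
    (d : Fin n → ℝ) (hd : ∀ i, d i = ∑ j ∈ Finset.univ.filter (fun j => i ∈ vars j), w j)
    (davg : ℝ) (hdavg : davg = (∑ i, d i) / n)
    (Λmax : ℝ)
    (hΛ : Λmax = Finset.univ.sup' Finset.univ_nonempty
      (fun j => (2 : ℝ) ^ (vars j).card / ((2 : ℝ) ^ (vars j).card - (s j : ℝ))))
    (r : ℕ) (x : Fin n → Bool)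
    (hlight : ∀ i, x i ≠ xstar i → d i ≤ 2 * davg)
    (hdist : (Finset.univ.filter fun i => x i ≠ xstar i).card ≤ r) :
    H x ≤ H xstar + 2 * Λmax * davg * r := by
  have hsD : ∀ j, (s j : ℝ) < (2 : ℝ) ^ (vars j).card := fun j => by
    have hlt : s j < 2 ^ (vars j).card := by
      have := hs j
      omega
    exact_mod_cast hlt
  set F := Finset.univ.filter fun i => x i ≠ xstar i with hF
  have hΛj : ∀ j, (2 : ℝ) ^ (vars j).card / ((2 : ℝ) ^ (vars j).card - (s j : ℝ)) ≤ Λmax :=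
    fun j => hΛ ▸ Finset.le_sup'
      (fun j => (2 : ℝ) ^ (vars j).card / ((2 : ℝ) ^ (vars j).card - (s j : ℝ)))
      (Finset.mem_univ j)
  have hΛ0 : 0 ≤ Λmax := by
    obtain ⟨j⟩ := ‹Nonempty J›
    exact (div_nonneg (by positivity) (sub_pos.2 (hsD j)).le).trans (hΛj j)
  have hd0 : ∀ i, 0 ≤ d i := fun i => by
    rw [hd i]
    exact Finset.sum_nonneg fun j _ => (hw j).le
  have hdavg0 : 0 ≤ davg := by
    rw [hdavg]
    exact div_nonneg (Finset.sum_nonneg fun i _ => hd0 i) (Nat.cast_nonneg n)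
  have hstep : H x ≤ H xstar + Λmax * ∑ j, (if ∃ i ∈ F, i ∈ vars j then w j else 0) := by
    rw [hH x, hH xstar, Finset.mul_sum, ← Finset.sum_add_distrib]
    refine Finset.sum_le_sum fun j _ => ?_
    by_cases h : ∃ i ∈ F, i ∈ vars j
    · rw [if_pos h]
      refine (centered_contribution_le_add (Nat.cast_nonneg (s j)) (hsD j) (hw j).le
        (sat j x = true) (sat j xstar = true)).trans ?_
      gcongr
      · exact (hw j).le
      · exact hΛj j
    · have hsat : sat j x = sat j xstar := hdep j x xstar fun i hi => by
        by_contra hne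
        exact h ⟨i, by simp [hF, hne], hi⟩
      rw [if_neg h, hsat, mul_zero, add_zero]
  have hdeg : ∑ j, (if ∃ i ∈ F, i ∈ vars j then w j else 0) ≤ 2 * davg * r :=
    calc ∑ j, (if ∃ i ∈ F, i ∈ vars j then w j else 0)
        ≤ ∑ i ∈ F, d i := by
          simp only [hd]
          convert sum_weight_touching_le_sum_degree vars w (fun j => (hw j).le) F
      _ ≤ F.card • (2 * davg) :=
          Finset.sum_le_card_nsmul F d _ fun i hi => hlight i (Finset.mem_filter.1 hi).2
      _ = 2 * davg * F.card := by rw [nsmul_eq_mul, mul_comm]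
      _ ≤ 2 * davg * r := by gcongr
  calc H x ≤ H xstar + Λmax * (2 * davg * r) := hstep.trans (by gcongr)
    _ = H xstar + 2 * Λmax * davg * r := by ring
end

section
/- Inclusion properties of the local-Lipschitz successful set (items 1 and 2 of Theorem 3.4): Consider a weighted MAX-k-CSP instance with objective H, optimum x*, and fix η ∈ (0,1). Define θ_η = η·|H_min|/(Λ_max·Σ), r_η^lip = ⌊θ_η·n/2⌋, and S_η^lip = B_{L_light}(x*, r_η^lip). Then: (1) S_η^lip ⊆ T_η, i.e. every x ∈ S_η^lip satisfies H(x) ≤ (1-η)·H_min; and (2) for every x ∈ S_η^lip, the restricted Hamming ball B_{L_light}(x, r_η^lip) contains an optimum assignment (namely x* itself). -/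
open scoped Classical

/-- A two-valued function on a cube of dimension `n` that takes the value `-w` on exactly
`s * 2 ^ (n - m)` points and `s * w / (2 ^ m - s)` elsewhere sums to zero. -/
lemma sum_centered_eq_zero {n m s : ℕ} (hm : m ≤ n) (w : ℝ) (hs : (s : ℝ) < 2 ^ m)
    (p : (Fin n → Bool) → Bool)
    (hp : (Finset.univ.filter fun x => p x = true).card = s * 2 ^ (n - m)) :
    ∑ x, (if p x then -w else (s : ℝ) * w / ((2 : ℝ) ^ m - (s : ℝ))) = 0 := by
  have hne : (2 : ℝ) ^ m - s ≠ 0 := by linarith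
  have hsplit := Finset.card_filter_add_card_filter_not
    (s := (Finset.univ : Finset (Fin n → Bool))) (fun x => p x = true)
  have hpow : (2 : ℝ) ^ n = 2 ^ m * 2 ^ (n - m) := by
    rw [← pow_add, Nat.add_sub_cancel' hm]
  have hcard : ((Finset.univ.filter fun x => ¬ p x = true).card : ℝ)
      = 2 ^ (n - m) * (2 ^ m - s) := by
    have h : ((Finset.univ.filter fun x => p x = true).card : ℝ)
        + ((Finset.univ.filter fun x => ¬ p x = true).card : ℝ) = 2 ^ n := by
      rw [← Nat.cast_add, hsplit]
      simp
    rw [hp] at h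
    push_cast at h
    linear_combination h + hpow
  rw [Finset.sum_ite, Finset.sum_const, Finset.sum_const, nsmul_eq_mul, nsmul_eq_mul, hcard, hp]
  push_cast
  field_simp
  ring

/-- Two values of a centered contribution with weight `w` differ by at most
`w * (N / (N - s))`. -/
lemma centered_sub_le {N s w : ℝ} (hw : 0 ≤ w) (hN : 0 ≤ N) (hs : s < N) (a b : Bool) :
    (if a then -w else s * w / (N - s)) - (if b then -w else s * w / (N - s))
      ≤ w * (N / (N - s)) := by
  have hpos : 0 < N - s := by linarith
  have hkey : s * w / (N - s) + w = w * (N / (N - s)) := by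
    field_simp
    ring
  have h : 0 ≤ w * (N / (N - s)) := by positivity
  cases a <;> cases b <;> simp <;> linarith

/-- **Inclusion properties of the local-Lipschitz successful set** (items 1 and 2 of
Theorem 3.4): for a weighted MAX-`k`-CSP instance with objective `H`, optimum `x*`, and
`η ∈ (0,1)`, set `θ_η = η·|H_min|/(Λ_max·Σ)`, `r_η^lip = ⌊θ_η·n/2⌋` and
`S_η^lip = B_{L_light}(x*, r_η^lip)`. Then (1) every `x ∈ S_η^lip` satisfies
`H(x) ≤ (1-η)·H_min`, i.e. `S_η^lip ⊆ T_η`, and (2) for every `x ∈ S_η^lip` the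
restricted Hamming ball `B_{L_light}(x, r_η^lip)` contains an optimum assignment,
namely `x*` itself.

The cube `{-1,1}^n` is encoded as `Fin n → Bool`; membership of `y` in `B_{L_light}(z,r)`
is expressed as: every flipped coordinate `i` (with `y i ≠ z i`) satisfies
`d i ≤ 2·d_avg`, and the number of flipped coordinates is at most `r`. -/
theorem local_lipschitz_successful_set_inclusions {n k : ℕ} {J : Type*} [Fintype J]
    [Nonempty J] (hn : 0 < n)
    (vars : J → Finset (Fin n)) (w : J → ℝ) (s : J → ℕ) (sat : J → (Fin n → Bool) → Bool)
    (hkj : ∀ j, 1 ≤ (vars j).card ∧ (vars j).card ≤ k)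
    (hw : ∀ j, 0 < w j)
    (hs : ∀ j, 1 ≤ s j ∧ s j ≤ 2 ^ (vars j).card - 1)
    (hdep : ∀ j x y, (∀ i ∈ vars j, x i = y i) → sat j x = sat j y)
    (hcount : ∀ j, (Finset.univ.filter fun x : Fin n → Bool => sat j x = true).card
      = s j * 2 ^ (n - (vars j).card))
    (H : (Fin n → Bool) → ℝ)
    (hH : ∀ x, H x = ∑ j, if sat j x then -(w j)
      else (s j : ℝ) * w j / ((2 : ℝ) ^ (vars j).card - (s j : ℝ)))
    (xstar : Fin n → Bool) (hopt : ∀ y, H xstar ≤ H y)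
    (d : Fin n → ℝ) (hd : ∀ i, d i = ∑ j ∈ Finset.univ.filter (fun j => i ∈ vars j), w j)
    (Stot : ℝ) (hStot : Stot = ∑ i, d i)
    (davg : ℝ) (hdavg : davg = Stot / n)
    (Λmax : ℝ)
    (hΛ : Λmax = Finset.univ.sup' Finset.univ_nonempty
      (fun j => (2 : ℝ) ^ (vars j).card / ((2 : ℝ) ^ (vars j).card - (s j : ℝ))))
    (η : ℝ) (hη0 : 0 < η) (hη1 : η < 1)
    (θ : ℝ) (hθ : θ = η * |H xstar| / (Λmax * Stot))
    (r : ℕ) (hr : r = ⌊θ * n / 2⌋₊)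
    (x : Fin n → Bool)
    (hlight : ∀ i, x i ≠ xstar i → d i ≤ 2 * davg)
    (hdist : (Finset.univ.filter fun i => x i ≠ xstar i).card ≤ r) :
    H x ≤ (1 - η) * H xstar ∧
      ((∀ i, xstar i ≠ x i → d i ≤ 2 * davg) ∧
        (Finset.univ.filter fun i => xstar i ≠ x i).card ≤ r ∧
        ∀ y, H xstar ≤ H y) := by
  have hsN : ∀ j, (s j : ℝ) < 2 ^ (vars j).card := fun j => by
    have h1 := (hs j).2
    have h2 : 0 < 2 ^ (vars j).card := by positivity
    have h3 : s j < 2 ^ (vars j).card := by omega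
    exact_mod_cast h3
  have hHmin : H xstar ≤ 0 := by
    have hsum : ∑ y, H y = 0 := by
      simp_rw [hH]
      rw [Finset.sum_comm]
      exact Finset.sum_eq_zero fun j _ => sum_centered_eq_zero
        ((Finset.card_le_univ _).trans_eq (Fintype.card_fin n)) (w j) (hsN j) (sat j) (hcount j)
    by_contra! hpos
    have : 0 < ∑ y, H y :=
      Finset.sum_pos (fun y _ => hpos.trans_le (hopt y)) Finset.univ_nonempty
    linarith
  have hΛj : ∀ j, (2 : ℝ) ^ (vars j).card / ((2 : ℝ) ^ (vars j).card - (s j : ℝ)) ≤ Λmax :=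
    fun j => hΛ ▸ Finset.le_sup'
      (fun j => (2 : ℝ) ^ (vars j).card / ((2 : ℝ) ^ (vars j).card - (s j : ℝ)))
      (Finset.mem_univ j)
  have hΛpos : 0 < Λmax := by
    obtain ⟨j⟩ := ‹Nonempty J›
    exact (div_pos (by positivity) (sub_pos.2 (hsN j))).trans_le (hΛj j)
  have hd0 : ∀ i, 0 ≤ d i := fun i => by
    rw [hd]
    exact Finset.sum_nonneg fun j _ => (hw j).le
  have hSpos : 0 < Stot := by
    obtain ⟨j⟩ := ‹Nonempty J›
    obtain ⟨i, hi⟩ := Finset.card_pos.1 (hkj j).1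
    rw [hStot]
    refine Finset.sum_pos' (fun i _ => hd0 i) ⟨i, Finset.mem_univ i, ?_⟩
    rw [hd]
    exact Finset.sum_pos (fun j _ => hw j) ⟨j, by simpa using hi⟩
  have hnpos : (0 : ℝ) < n := by exact_mod_cast hn
  set D := Finset.univ.filter fun i => x i ≠ xstar i with hD
  have hterm : ∀ j,
      (if sat j x then -(w j) else (s j : ℝ) * w j / ((2 : ℝ) ^ (vars j).card - (s j : ℝ)))
      - (if sat j xstar then -(w j)
        else (s j : ℝ) * w j / ((2 : ℝ) ^ (vars j).card - (s j : ℝ)))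
      ≤ ∑ i ∈ D, if i ∈ vars j then Λmax * w j else 0 := fun j => by
    have hnn : ∀ i ∈ D, 0 ≤ if i ∈ vars j then Λmax * w j else 0 := fun i _ => by
      have := mul_pos hΛpos (hw j)
      split_ifs <;> linarith
    by_cases hex : ∃ i ∈ vars j, x i ≠ xstar i
    · obtain ⟨i, hi, hne⟩ := hex
      calc _ ≤ w j * ((2 : ℝ) ^ (vars j).card / ((2 : ℝ) ^ (vars j).card - (s j : ℝ))) :=
            centered_sub_le (hw j).le (by positivity) (hsN j) _ _
        _ ≤ Λmax * w j := by
            rw [mul_comm]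
            exact mul_le_mul_of_nonneg_right (hΛj j) (hw j).le
        _ = if i ∈ vars j then Λmax * w j else 0 := (if_pos hi).symm
        _ ≤ _ := Finset.single_le_sum hnn (by simpa [hD] using hne)
    · push Not at hex
      rw [hdep j x xstar hex, sub_self]
      exact Finset.sum_nonneg hnn
  have hdiff : H x - H xstar ≤ Λmax * ∑ i ∈ D, d i := by
    rw [hH, hH, ← Finset.sum_sub_distrib]
    refine (Finset.sum_le_sum fun j _ => hterm j).trans_eq ?_
    rw [Finset.sum_comm, Finset.mul_sum]
    refine Finset.sum_congr rfl fun i _ => ?_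
    rw [hd, Finset.mul_sum, Finset.sum_filter]
  have hθ0 : 0 ≤ θ := by
    rw [hθ]
    positivity
  have hcard : (D.card : ℝ) ≤ θ * n / 2 :=
    (Nat.cast_le.2 (hdist.trans_eq hr)).trans (Nat.floor_le (by positivity))
  have hsumd : ∑ i ∈ D, d i ≤ θ * Stot := by
    calc ∑ i ∈ D, d i ≤ D.card • (2 * davg) :=
          Finset.sum_le_card_nsmul _ _ _ fun i hi => hlight i (by simpa [hD] using hi)
      _ = D.card * (2 * (Stot / n)) := by rw [nsmul_eq_mul, hdavg]
      _ ≤ θ * n / 2 * (2 * (Stot / n)) := mul_le_mul_of_nonneg_right hcard (by positivity)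
      _ = θ * Stot := by field_simp
  have hbudget : Λmax * (θ * Stot) = -(η * H xstar) := by
    rw [hθ, abs_of_nonpos hHmin]
    field_simp
  refine ⟨?_, fun i hi => hlight i hi.symm, ?_, hopt⟩
  · linarith [mul_le_mul_of_nonneg_left hsumd hΛpos.le]
  · simpa only [hD, ne_comm] using hdist
end

section
/- Size lower bound for the local-Lipschitz successful set (item 3 of Theorem 3.4, explicit form): Consider a weighted MAX-k-CSP instance on n ≥ 2 variables with objective H and optimum x*, fix η ∈ (0,1), and define θ_η = η·|H_min|/(Λ_max·Σ), r_η^lip = ⌊θ_η·n/2⌋, and S_η^lip = B_{L_light}(x*, r_η^lip). Then, with N = ⌊n/2⌋, one has |S_η^lip| ≥ (1/(e·N·(N+1)))·2^{N·h(θ_η)}. In particular |S_η^lip| ≥ 2^{(1/2)·h(θ_η)·n - o(n)}. -/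
open scoped Classical

noncomputable section

/-- The binary entropy function `h(t) = -t·log₂ t - (1-t)·log₂(1-t)`. -/
def binEnt (t : ℝ) : ℝ := -t * Real.logb 2 t - (1 - t) * Real.logb 2 (1 - t)

end

open Real in
lemma two_rpow_mul_binEnt (x t : ℝ) : (2 : ℝ) ^ (x * binEnt t) = exp (x * binEntropy t) := by
  have h2 : log 2 ≠ 0 := (log_pos one_lt_two).ne'
  rw [rpow_def_of_pos two_pos, binEnt, binEntropy_eq_negMulLog_add_negMulLog_one_sub, negMulLog,
    negMulLog, logb, logb]
  congr 1
  field_simp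
  ring

open Nat in
lemma factorial_mul_pow_le_factorial_mul_pow (m l : ℕ) : m ! * m ^ l ≤ l ! * m ^ m := by
  rcases le_total m l with h | h
  · calc m ! * m ^ l = (m ! * m ^ (l - m)) * m ^ m := by
          rw [mul_assoc, ← pow_add, Nat.sub_add_cancel h]
      _ ≤ l ! * m ^ m := Nat.mul_le_mul_right _ (Nat.factorial_mul_pow_sub_le_factorial h)
  · have h1 := Nat.factorial_mul_descFactorial (Nat.sub_le m l)
    rw [Nat.sub_sub_self h] at h1
    calc m ! * m ^ l = l ! * (m.descFactorial (m - l) * m ^ l) := by rw [← h1, mul_assoc]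
      _ ≤ l ! * (m ^ (m - l) * m ^ l) := by
          gcongr
          exact Nat.descFactorial_le_pow _ _
      _ = l ! * m ^ m := by rw [← pow_add, Nat.sub_add_cancel h]

open Nat in
/-- The binomial distribution with parameters `N` and `m / N` has mode `m`. -/
lemma choose_mul_pow_mul_pow_le {N m l : ℕ} (hm : m ≤ N) (hl : l ≤ N) :
    m ^ l * (N - m) ^ (N - l) * N.choose l ≤ m ^ m * (N - m) ^ (N - m) * N.choose m := by
  have h := Nat.mul_le_mul (factorial_mul_pow_le_factorial_mul_pow m l)
    (factorial_mul_pow_le_factorial_mul_pow (N - m) (N - l))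
  have cl := Nat.choose_mul_factorial_mul_factorial hl
  have cm := Nat.choose_mul_factorial_mul_factorial hm
  have pos : 0 < (m ! * (N - m)!) * (l ! * (N - l)!) := by positivity
  refine Nat.le_of_mul_le_mul_right ?_ pos
  calc m ^ l * (N - m) ^ (N - l) * N.choose l * ((m ! * (N - m)!) * (l ! * (N - l)!))
      = (m ! * m ^ l * ((N - m)! * (N - m) ^ (N - l))) * (N.choose l * l ! * (N - l)!) := by ring
    _ ≤ (l ! * m ^ m * ((N - l)! * (N - m) ^ (N - m))) * (N.choose l * l ! * (N - l)!) := by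
        gcongr
    _ = (l ! * m ^ m * ((N - l)! * (N - m) ^ (N - m))) * (N.choose m * m ! * (N - m)!) := by
        rw [cl, cm]
    _ = m ^ m * (N - m) ^ (N - m) * N.choose m * ((m ! * (N - m)!) * (l ! * (N - l)!)) := by ring

lemma pow_le_succ_mul_choose {N m : ℕ} (hm : m ≤ N) :
    N ^ N ≤ (N + 1) * (m ^ m * (N - m) ^ (N - m) * N.choose m) := by
  calc N ^ N = (m + (N - m)) ^ N := by rw [Nat.add_sub_cancel' hm]
    _ = ∑ l ∈ Finset.range (N + 1), m ^ l * (N - m) ^ (N - l) * N.choose l := add_pow _ _ _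
    _ ≤ ∑ _l ∈ Finset.range (N + 1), m ^ m * (N - m) ^ (N - m) * N.choose m :=
        Finset.sum_le_sum fun l hl =>
          choose_mul_pow_mul_pow_le hm (Nat.lt_succ_iff.mp (Finset.mem_range.mp hl))
    _ = _ := by rw [Finset.sum_const, Finset.card_range, smul_eq_mul]

open Real in
lemma exp_mul_log_self (a : ℕ) : exp ((a : ℝ) * log a) = (a : ℝ) ^ a := by
  rcases Nat.eq_zero_or_pos a with rfl | ha
  · simp
  · rw [exp_nat_mul, exp_log (by exact_mod_cast ha)]

open Real in
lemma mul_negMulLog_div {x y : ℝ} (hy : y ≠ 0) :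
    y * negMulLog (x / y) = x * log y - x * log x := by
  rcases eq_or_ne x 0 with rfl | hx
  · simp
  · rw [negMulLog, log_div hx hy]
    field_simp
    ring

open Real in
lemma exp_mul_binEntropy_div_le {N m : ℕ} (hN : 0 < N) (hm : m ≤ N) :
    exp (N * binEntropy (m / N)) ≤ (N + 1) * N.choose m := by
  have hN' : (N : ℝ) ≠ 0 := by exact_mod_cast hN.ne'
  have e1 : (1 : ℝ) - m / N = ((N - m : ℕ) : ℝ) / N := by
    rw [Nat.cast_sub hm]; field_simp
  have e2 : (N : ℝ) * binEntropy (m / N) + (m * log m + ((N - m : ℕ) : ℝ) * log (N - m : ℕ))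
      = N * log N := by
    rw [binEntropy_eq_negMulLog_add_negMulLog_one_sub, e1, mul_add, mul_negMulLog_div hN',
      mul_negMulLog_div hN', Nat.cast_sub hm]
    ring
  have e3 := congrArg exp e2
  rw [exp_add, exp_add, exp_mul_log_self, exp_mul_log_self, exp_mul_log_self] at e3
  have hpos : (0 : ℝ) < (m : ℝ) ^ m * ((N - m : ℕ) : ℝ) ^ (N - m) := by
    rw [← exp_mul_log_self, ← exp_mul_log_self]; positivity
  have h : (N : ℝ) ^ N ≤ (N + 1) * ((m : ℝ) ^ m * ((N - m : ℕ) : ℝ) ^ (N - m) * N.choose m) := by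
    exact_mod_cast pow_le_succ_mul_choose hm
  refine le_of_mul_le_mul_right ?_ hpos
  rw [e3]
  linarith

open Real in
lemma binEntropy_add_le {a b : ℝ} (ha : 0 ≤ a) (hb : 0 ≤ b) (hab : a + b ≤ 1) :
    binEntropy (a + b) ≤ binEntropy a + binEntropy b := by
  rcases (add_nonneg ha hb).eq_or_lt with h0 | hpos
  · obtain rfl : a = 0 := by linarith
    obtain rfl : b = 0 := by linarith
    simp
  have hc := strictConcave_binEntropy.concaveOn
  have key : ∀ u v : ℝ, 0 ≤ u → 0 ≤ v → u + v = a + b →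
      u / (a + b) * binEntropy (a + b) ≤ binEntropy u := by
    intro u v hu hv huv
    have h := hc.2 (show a + b ∈ Set.Icc (0 : ℝ) 1 from ⟨hpos.le, hab⟩)
      (show (0 : ℝ) ∈ Set.Icc (0 : ℝ) 1 from ⟨le_rfl, zero_le_one⟩)
      (div_nonneg hu hpos.le) (div_nonneg hv hpos.le)
      (by rw [← add_div, huv, div_self hpos.ne'])
    simpa [div_mul_cancel₀ _ hpos.ne'] using h
  have h1 := key a b ha hb rfl
  have h2 := key b a hb ha (add_comm _ _)
  calc binEntropy (a + b) = a / (a + b) * binEntropy (a + b) + b / (a + b) * binEntropy (a + b) := by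
        field_simp
    _ ≤ _ := add_le_add h1 h2

open Real in
lemma mul_binEntropy_div_le {y δ : ℝ} (hy : 1 ≤ y) (h0 : 0 ≤ δ) (h1 : δ < 1) :
    y * binEntropy (δ / y) ≤ 1 + log y := by
  have hy0 : 0 < y := by linarith
  have hyδ : 0 < y - δ := by linarith
  have e1 : 1 - δ / y = (y - δ) / y := by field_simp
  rw [binEntropy_eq_negMulLog_add_negMulLog_one_sub, e1, mul_add, mul_negMulLog_div hy0.ne',
    mul_negMulLog_div hy0.ne']
  have hlog : 0 ≤ log y := log_nonneg hy
  have b1 : (y - δ) * (log y - log (y - δ)) ≤ δ := by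
    rw [← log_div hy0.ne' hyδ.ne']
    calc (y - δ) * log (y / (y - δ)) ≤ (y - δ) * (y / (y - δ) - 1) :=
          mul_le_mul_of_nonneg_left (log_le_sub_one_of_pos (by positivity)) hyδ.le
      _ = δ := by field_simp; ring
  have b2 : -(δ * log δ) ≤ 1 - δ := by
    rcases h0.eq_or_lt with rfl | hδ
    · simp
    have h := mul_le_mul_of_nonneg_left (one_sub_inv_le_log_of_pos hδ) h0
    have : δ * (1 - δ⁻¹) = δ - 1 := by field_simp
    linarith
  nlinarith

open Real in
/-- Entropy lower bound for the binomial coefficient at the rounded-down index. -/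
lemma exp_mul_binEntropy_le_choose_floor {N : ℕ} (hN : 0 < N) {θ : ℝ} (h0 : 0 ≤ θ) (h1 : θ ≤ 1) :
    exp (N * binEntropy θ) ≤ exp 1 * N * (N + 1) * N.choose ⌊θ * N⌋₊ := by
  have hN1 : (1 : ℝ) ≤ N := by exact_mod_cast hN
  have hN0 : (0 : ℝ) < N := by linarith
  set m := ⌊θ * N⌋₊
  have hm1 : (m : ℝ) ≤ θ * N := Nat.floor_le (by positivity)
  have hm2 : θ * N < m + 1 := Nat.lt_floor_add_one _
  have hmN : m ≤ N := by
    have : (m : ℝ) ≤ N := hm1.trans (mul_le_of_le_one_left hN0.le h1)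
    exact_mod_cast this
  have split : (m : ℝ) / N + (θ * N - m) / N = θ := by field_simp; ring
  have hsub := binEntropy_add_le (a := (m : ℝ) / N) (b := (θ * N - m) / N) (by positivity)
    (div_nonneg (by linarith) hN0.le) (split.trans_le h1)
  rw [split] at hsub
  have hrem := mul_binEntropy_div_le hN1 (δ := θ * N - m) (by linarith) (by linarith)
  calc exp (N * binEntropy θ) ≤ exp (N * binEntropy (m / N) + (1 + log N)) := by
        apply exp_le_exp.mpr
        have := mul_le_mul_of_nonneg_left hsub hN0.le
        linarith
    _ = exp (N * binEntropy (m / N)) * (exp 1 * N) := by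
        rw [exp_add, exp_add 1, exp_log hN0]
    _ ≤ (N + 1) * N.choose m * (exp 1 * N) :=
        mul_le_mul_of_nonneg_right (exp_mul_binEntropy_div_le hN hmN) (by positivity)
    _ = _ := by ring

/-- At least half of a family of nonnegative reals is at most twice the average. -/
lemma half_le_card_filter_le_two_mul_average {n : ℕ} {d : Fin n → ℝ} (hd : ∀ i, 0 ≤ d i)
    (hpos : 0 < ∑ i, d i) :
    n / 2 ≤ (Finset.univ.filter fun i => d i ≤ 2 * ((∑ i, d i) / n)).card := by
  set S := ∑ i, d i
  have hsum := Finset.card_filter_add_card_filter_not (s := (Finset.univ : Finset (Fin n)))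
    (fun i => d i ≤ 2 * (S / n))
  rw [Finset.card_univ, Fintype.card_fin] at hsum
  set heavy := Finset.univ.filter fun i => ¬ d i ≤ 2 * (S / n)
  have hn : (0 : ℝ) < n := by
    rcases Nat.eq_zero_or_pos n with rfl | h
    · simp [S] at hpos
    · exact_mod_cast h
  have h1 : (heavy.card : ℝ) * (2 * (S / n)) ≤ S := by
    calc (heavy.card : ℝ) * (2 * (S / n)) = ∑ _i ∈ heavy, 2 * (S / n) := by
          rw [Finset.sum_const, nsmul_eq_mul]
      _ ≤ ∑ i ∈ heavy, d i :=
          Finset.sum_le_sum fun i hi => (not_le.mp (Finset.mem_filter.mp hi).2).le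
      _ ≤ S := Finset.sum_le_sum_of_subset_of_nonneg (Finset.subset_univ _) fun i _ _ => hd i
  have h2 : (heavy.card : ℝ) * 2 ≤ n := by
    have : (heavy.card : ℝ) * (2 * (S / n)) = (heavy.card * 2) / n * S := by ring
    rw [this] at h1
    have h3 : (heavy.card * 2 : ℝ) / n ≤ 1 := by
      by_contra! h
      nlinarith
    rwa [div_le_one hn] at h3
  have h3 : heavy.card * 2 ≤ n := by exact_mod_cast h2
  omega

/-- A Hamming ball of radius `r` restricted to the coordinates satisfying `P` has at least
`C(N, m)` points whenever `m ≤ r` and at least `N` coordinates satisfy `P`. -/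
lemma choose_le_card_restricted_ball {n N m r : ℕ} (x₀ : Fin n → Bool) (P : Fin n → Prop)
    (hN : N ≤ (Finset.univ.filter P).card) (hm : m ≤ r) :
    N.choose m ≤ (Finset.univ.filter fun x : Fin n → Bool =>
      (∀ i, x i ≠ x₀ i → P i) ∧ (Finset.univ.filter fun i => x i ≠ x₀ i).card ≤ r).card := by
  let f : Finset (Fin n) → Fin n → Bool := fun T i => if i ∈ T then !(x₀ i) else x₀ i
  have hf : ∀ T i, f T i ≠ x₀ i ↔ i ∈ T := by
    intro T i
    by_cases h : i ∈ T <;> simp [f, h]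
  calc N.choose m ≤ (Finset.univ.filter P).card.choose m := Nat.choose_le_choose _ hN
    _ = (Finset.powersetCard m (Finset.univ.filter P)).card := (Finset.card_powersetCard _ _).symm
    _ ≤ _ := by
      apply Finset.card_le_card_of_injOn f
      · intro T hT
        obtain ⟨hsub, hcard⟩ := Finset.mem_powersetCard.mp hT
        refine Finset.mem_filter.mpr ⟨Finset.mem_univ _, fun i hi => ?_, ?_⟩
        · exact (Finset.mem_filter.mp (hsub ((hf T i).mp hi))).2
        · simp only [hf, Finset.filter_univ_mem]
          omega
      · intro T _ T' _ h
        ext i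
        rw [← hf T i, ← hf T' i, h]

/-- **Size lower bound for the local-Lipschitz successful set** (item 3 of Theorem 3.4,
explicit form): for a weighted MAX-`k`-CSP instance on `n ≥ 2` variables with objective
`H`, optimum `x*`, and `η ∈ (0,1)`, define `θ_η = η·|H_min|/(Λ_max·Σ)`,
`r_η^lip = ⌊θ_η·n/2⌋` and `S_η^lip = B_{L_light}(x*, r_η^lip)`. Then, with `N = ⌊n/2⌋`,
`|S_η^lip| ≥ (1/(e·N·(N+1)))·2^{N·h(θ_η)}`.

The cube `{-1,1}^n` is encoded as `Fin n → Bool`, and `S_η^lip` is the set of points `x`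
all of whose flipped coordinates (w.r.t. `x*`) are light (`d i ≤ 2·d_avg`) and whose
number of flipped coordinates is at most `r_η^lip`. -/
theorem local_lipschitz_successful_set_size {n k : ℕ} {J : Type*} [Fintype J]
    [Nonempty J] (hn : 2 ≤ n)
    (vars : J → Finset (Fin n)) (w : J → ℝ) (s : J → ℕ) (sat : J → (Fin n → Bool) → Bool)
    (hkj : ∀ j, 1 ≤ (vars j).card ∧ (vars j).card ≤ k)
    (hw : ∀ j, 0 < w j)
    (hs : ∀ j, 1 ≤ s j ∧ s j ≤ 2 ^ (vars j).card - 1)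
    (hdep : ∀ j x y, (∀ i ∈ vars j, x i = y i) → sat j x = sat j y)
    (hcount : ∀ j, (Finset.univ.filter fun x : Fin n → Bool => sat j x = true).card
      = s j * 2 ^ (n - (vars j).card))
    (H : (Fin n → Bool) → ℝ)
    (hH : ∀ x, H x = ∑ j, if sat j x then -(w j)
      else (s j : ℝ) * w j / ((2 : ℝ) ^ (vars j).card - (s j : ℝ)))
    (xstar : Fin n → Bool) (hopt : ∀ y, H xstar ≤ H y)
    (d : Fin n → ℝ) (hd : ∀ i, d i = ∑ j ∈ Finset.univ.filter (fun j => i ∈ vars j), w j)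
    (Stot : ℝ) (hStot : Stot = ∑ i, d i)
    (davg : ℝ) (hdavg : davg = Stot / n)
    (Λmax : ℝ)
    (hΛ : Λmax = Finset.univ.sup' Finset.univ_nonempty
      (fun j => (2 : ℝ) ^ (vars j).card / ((2 : ℝ) ^ (vars j).card - (s j : ℝ))))
    (η : ℝ) (hη0 : 0 < η) (hη1 : η < 1)
    (θ : ℝ) (hθ : θ = η * |H xstar| / (Λmax * Stot))
    (r : ℕ) (hr : r = ⌊θ * n / 2⌋₊)
    (N : ℕ) (hN : N = n / 2)
    (Slip : Finset (Fin n → Bool))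
    (hSlip : Slip = Finset.univ.filter fun x : Fin n → Bool =>
      (∀ i, x i ≠ xstar i → d i ≤ 2 * davg) ∧
        (Finset.univ.filter fun i => x i ≠ xstar i).card ≤ r) :
    (1 / (Real.exp 1 * N * ((N : ℝ) + 1))) * (2 : ℝ) ^ ((N : ℝ) * binEnt θ)
      ≤ (Slip.card : ℝ) := by
  have hpow : ∀ j, (s j : ℝ) + 1 ≤ (2 : ℝ) ^ (vars j).card := by
    intro j
    have h1 := hs j
    have h2 : s j + 1 ≤ 2 ^ (vars j).card := by omega
    exact_mod_cast h2
  have hΛj : ∀ j, (2 : ℝ) ^ (vars j).card / ((2 : ℝ) ^ (vars j).card - (s j : ℝ)) ≤ Λmax := by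
    intro j
    rw [hΛ]
    exact Finset.le_sup' (fun j => (2 : ℝ) ^ (vars j).card / ((2 : ℝ) ^ (vars j).card - (s j : ℝ)))
      (Finset.mem_univ j)
  have hΛ1 : 1 ≤ Λmax := by
    obtain ⟨j⟩ := ‹Nonempty J›
    refine le_trans ?_ (hΛj j)
    rw [one_le_div (by linarith [hpow j])]
    linarith [(s j).cast_nonneg (α := ℝ)]
  have hterm : ∀ j, |if sat j xstar then -(w j)
      else (s j : ℝ) * w j / ((2 : ℝ) ^ (vars j).card - (s j : ℝ))| ≤ Λmax * w j := by
    intro j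
    have hwj := hw j
    have hden : (0 : ℝ) < (2 : ℝ) ^ (vars j).card - (s j : ℝ) := by linarith [hpow j]
    split_ifs
    · rw [abs_neg, abs_of_pos hwj]
      nlinarith
    · rw [abs_of_nonneg (by positivity), mul_div_right_comm]
      refine mul_le_mul_of_nonneg_right (le_trans ?_ (hΛj j)) hwj.le
      gcongr
      linarith [hpow j]
  have hHabs : |H xstar| ≤ Λmax * ∑ j, w j := by
    rw [hH, Finset.mul_sum]
    exact (Finset.abs_sum_le_sum_abs _ _).trans (Finset.sum_le_sum fun j _ => hterm j)
  have hwS : ∑ j, w j ≤ Stot := by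
    have h : Stot = ∑ j, ((vars j).card : ℝ) * w j := by
      simp only [hStot, hd, Finset.sum_filter]
      rw [Finset.sum_comm]
      refine Finset.sum_congr rfl fun j _ => ?_
      rw [← Finset.sum_filter, Finset.filter_univ_mem, Finset.sum_const, nsmul_eq_mul]
    rw [h]
    refine Finset.sum_le_sum fun j _ => le_mul_of_one_le_left (hw j).le ?_
    exact_mod_cast (hkj j).1
  have hS0 : 0 < Stot := (Finset.sum_pos (fun j _ => hw j) Finset.univ_nonempty).trans_le hwS
  have hden : 0 < Λmax * Stot := mul_pos (by linarith) hS0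
  have hθ0 : 0 ≤ θ := by rw [hθ]; positivity
  have hθ1 : θ ≤ 1 := by
    rw [hθ, div_le_one hden]
    calc η * |H xstar| ≤ |H xstar| := mul_le_of_le_one_left (abs_nonneg _) hη1.le
      _ ≤ Λmax * ∑ j, w j := hHabs
      _ ≤ Λmax * Stot := mul_le_mul_of_nonneg_left hwS (by linarith)
  have hN0 : 0 < N := by omega
  have hNn : (N : ℝ) ≤ n / 2 := by rw [hN]; exact Nat.cast_div_le
  have hmr : ⌊θ * N⌋₊ ≤ r := by
    rw [hr, mul_div_assoc]
    exact Nat.floor_le_floor (mul_le_mul_of_nonneg_left hNn hθ0)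
  have hlight : N ≤ (Finset.univ.filter fun i => d i ≤ 2 * davg).card := by
    rw [hN, hdavg, hStot]
    refine half_le_card_filter_le_two_mul_average (fun i => ?_) (hStot ▸ hS0)
    rw [hd]
    exact Finset.sum_nonneg fun j _ => (hw j).le
  have hcard : N.choose ⌊θ * N⌋₊ ≤ Slip.card := by
    rw [hSlip]
    exact choose_le_card_restricted_ball xstar (fun i => d i ≤ 2 * davg) hlight hmr
  have hN0' : (0 : ℝ) < N := by exact_mod_cast hN0
  rw [two_rpow_mul_binEnt, one_div, inv_mul_le_iff₀ (by positivity)]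
  refine (exp_mul_binEntropy_le_choose_floor hN0 hθ0 hθ1).trans ?_
  gcongr
end

section
/- McDiarmid threshold-set bound (Proposition 4.3): Consider a weighted MAX-k-CSP instance on n variables with objective H (with Σ > 0 and H_min < 0), and let η ∈ (0,1). Then the threshold set T_η = {x ∈ {-1,1}^n : H(x) ≤ (1-η)·H_min} satisfies |T_η| ≤ 2^{(1-γ_η)·n}, where γ_η = (2·(1-η)²/ln 2)·(1/(Λ_max²·D))·(|H_min|/Σ)² and D = n·(Σ_{i=1}^n d_i²)/Σ² is the irregularity parameter. -/
open scoped Classical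

/-- Exponential-moment form of McDiarmid's bounded-difference inequality on the Boolean cube. -/
theorem sum_exp_le_of_bounded_differences {n : ℕ} (f : (Fin n → Bool) → ℝ) (c : Fin n → ℝ)
    (hf : ∀ i x b, |f (Function.update x i b) - f x| ≤ c i) :
    ∑ x, Real.exp (f x) ≤
      2 ^ n * Real.exp ((∑ x, f x) / 2 ^ n + (∑ i, c i ^ 2) / 8) := by
  induction n with
  | zero => simp
  | succ n ih =>
    have hsplit : ∀ F : (Fin (n + 1) → Bool) → ℝ,
        ∑ x, F x = ∑ y : Fin n → Bool, (F (Fin.cons true y) + F (Fin.cons false y)) := by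
      intro F
      rw [← (Fin.consEquiv fun _ : Fin (n + 1) => Bool).sum_comp, Fintype.sum_prod_type,
        Fintype.sum_bool, ← Finset.sum_add_distrib]
      rfl
    have hg := ih
      (fun y => (f (Fin.cons true y) + f (Fin.cons false y)) / 2) (fun i => c i.succ) (by
        intro i y b
        have h1 := hf i.succ (Fin.cons true y) b
        have h2 := hf i.succ (Fin.cons false y) b
        rw [← Fin.cons_update] at h1 h2
        rw [abs_le] at *
        constructor <;> linarith [h1.1, h1.2, h2.1, h2.2])
    have hpoint : ∀ y : Fin n → Bool,
        Real.exp (f (Fin.cons true y)) + Real.exp (f (Fin.cons false y)) ≤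
          2 * Real.exp (c 0 ^ 2 / 8) *
            Real.exp ((f (Fin.cons true y) + f (Fin.cons false y)) / 2) := by
      intro y
      have h0 := hf 0 (Fin.cons false y) true
      rw [Fin.update_cons_zero] at h0
      generalize f (Fin.cons true y) = a at *
      generalize f (Fin.cons false y) = b at *
      have hsq : (a - b) ^ 2 ≤ c 0 ^ 2 := sq_le_sq.2 (h0.trans (le_abs_self _))
      have hcosh : Real.cosh ((a - b) / 2) ≤ Real.exp (c 0 ^ 2 / 8) :=
        (Real.cosh_le_exp_half_sq _).trans (Real.exp_le_exp.2 (by linarith))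
      have heq : Real.exp a + Real.exp b =
          2 * Real.cosh ((a - b) / 2) * Real.exp ((a + b) / 2) := by
        rw [Real.cosh_eq, mul_div_cancel₀ _ (two_ne_zero' ℝ), add_mul, ← Real.exp_add,
          ← Real.exp_add]
        congr 2 <;> ring
      rw [heq]
      gcongr
    rw [hsplit, hsplit f, Fin.sum_univ_succ]
    calc _ ≤ ∑ y : Fin n → Bool, 2 * Real.exp (c 0 ^ 2 / 8) *
            Real.exp ((f (Fin.cons true y) + f (Fin.cons false y)) / 2) :=
          Finset.sum_le_sum fun y _ => hpoint y
      _ ≤ 2 * Real.exp (c 0 ^ 2 / 8) * (2 ^ n * Real.exp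
            ((∑ y : Fin n → Bool, (f (Fin.cons true y) + f (Fin.cons false y)) / 2) / 2 ^ n +
              (∑ i : Fin n, c i.succ ^ 2) / 8)) := by
          rw [← Finset.mul_sum]
          exact mul_le_mul_of_nonneg_left hg (by positivity)
      _ = _ := by
          rw [mul_mul_mul_comm, ← Real.exp_add, ← Finset.sum_div, pow_succ' (2 : ℝ)]
          congr 2
          field_simp
          ring

/-- McDiarmid's inequality for the lower tail of a mean-zero function on the Boolean cube. -/
theorem card_le_neg_of_bounded_differences {n : ℕ} (f : (Fin n → Bool) → ℝ) (c : Fin n → ℝ)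
    (hf : ∀ i x b, |f (Function.update x i b) - f x| ≤ c i) (hmean : ∑ x, f x = 0)
    (hc : 0 < ∑ i, c i ^ 2) {t : ℝ} (ht : 0 ≤ t) :
    ((Finset.univ.filter fun x => f x ≤ -t).card : ℝ) ≤
      2 ^ n * Real.exp (-(2 * t ^ 2 / ∑ i, c i ^ 2)) := by
  set V := ∑ i, c i ^ 2 with hV
  set l := 4 * t / V with hl
  have hl0 : 0 ≤ l := by positivity
  have hmgf := sum_exp_le_of_bounded_differences (fun x => -l * f x) (fun i => l * c i) (by
    intro i x b
    rw [← mul_sub, abs_mul, abs_neg, abs_of_nonneg hl0]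
    exact mul_le_mul_of_nonneg_left (hf i x b) hl0)
  simp only [mul_pow] at hmgf
  rw [← Finset.mul_sum, hmean, ← Finset.mul_sum, ← hV] at hmgf
  have hmarkov : ((Finset.univ.filter fun x => f x ≤ -t).card : ℝ) * Real.exp (l * t) ≤
      ∑ x, Real.exp (-l * f x) := by
    rw [← nsmul_eq_mul]
    refine (Finset.card_nsmul_le_sum _ (fun x => Real.exp (-l * f x)) _ ?_).trans
      (Finset.sum_le_univ_sum_of_nonneg fun x => (Real.exp_pos _).le)
    intro x hx
    have hx' := (Finset.mem_filter.1 hx).2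
    exact Real.exp_le_exp.2 (by nlinarith)
  rw [← mul_le_mul_iff_of_pos_right (Real.exp_pos (l * t))]
  refine (hmarkov.trans hmgf).trans_eq ?_
  rw [mul_assoc, ← Real.exp_add]
  congr 2
  rw [hl]
  field_simp
  ring

/-- **McDiarmid threshold-set bound** (Proposition 4.3): for a weighted MAX-`k`-CSP
instance on `n` variables with objective `H` (with `Σ > 0` and `H_min < 0`) and
`η ∈ (0,1)`, the threshold set `T_η = {x ∈ {-1,1}^n : H(x) ≤ (1-η)·H_min}` satisfies
`|T_η| ≤ 2^{(1-γ_η)·n}`, where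
`γ_η = (2·(1-η)²/ln 2)·(1/(Λ_max²·D))·(|H_min|/Σ)²` and
`D = n·(∑ d_i²)/Σ²` is the irregularity parameter.

The cube `{-1,1}^n` is encoded as `Fin n → Bool`. -/
theorem mcdiarmid_threshold_set_bound {n k : ℕ} {J : Type*} [Fintype J]
    [Nonempty J] (hn : 0 < n)
    (vars : J → Finset (Fin n)) (w : J → ℝ) (s : J → ℕ) (sat : J → (Fin n → Bool) → Bool)
    (hkj : ∀ j, 1 ≤ (vars j).card ∧ (vars j).card ≤ k)
    (hw : ∀ j, 0 < w j)
    (hs : ∀ j, 1 ≤ s j ∧ s j ≤ 2 ^ (vars j).card - 1)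
    (hdep : ∀ j x y, (∀ i ∈ vars j, x i = y i) → sat j x = sat j y)
    (hcount : ∀ j, (Finset.univ.filter fun x : Fin n → Bool => sat j x = true).card
      = s j * 2 ^ (n - (vars j).card))
    (H : (Fin n → Bool) → ℝ)
    (hH : ∀ x, H x = ∑ j, if sat j x then -(w j)
      else (s j : ℝ) * w j / ((2 : ℝ) ^ (vars j).card - (s j : ℝ)))
    (xstar : Fin n → Bool) (hopt : ∀ y, H xstar ≤ H y)
    (hmin : H xstar < 0)
    (d : Fin n → ℝ) (hd : ∀ i, d i = ∑ j ∈ Finset.univ.filter (fun j => i ∈ vars j), w j)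
    (Stot : ℝ) (hStot : Stot = ∑ i, d i) (hSpos : 0 < Stot)
    (Λmax : ℝ)
    (hΛ : Λmax = Finset.univ.sup' Finset.univ_nonempty
      (fun j => (2 : ℝ) ^ (vars j).card / ((2 : ℝ) ^ (vars j).card - (s j : ℝ))))
    (D : ℝ) (hD : D = (n : ℝ) * (∑ i, d i ^ 2) / Stot ^ 2)
    (η : ℝ) (hη0 : 0 < η) (hη1 : η < 1)
    (γ : ℝ) (hγ : γ = (2 * (1 - η) ^ 2 / Real.log 2) * (1 / (Λmax ^ 2 * D)) *
      (|H xstar| / Stot) ^ 2) :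
    (((Finset.univ.filter fun x : Fin n → Bool =>
        H x ≤ (1 - η) * H xstar).card : ℝ))
      ≤ (2 : ℝ) ^ ((1 - γ) * n) := by
  have hsr : ∀ j, (1 : ℝ) ≤ s j ∧ 0 < (2 : ℝ) ^ (vars j).card - s j := by
    intro j
    obtain ⟨h1, h2⟩ := hs j
    have h3 : s j < 2 ^ (vars j).card := by
      have := Nat.one_le_two_pow (n := (vars j).card)
      omega
    exact ⟨by exact_mod_cast h1, sub_pos.2 (by exact_mod_cast h3)⟩
  have hΛj : ∀ j, (2 : ℝ) ^ (vars j).card / ((2 : ℝ) ^ (vars j).card - s j) ≤ Λmax := by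
    intro j
    rw [hΛ]
    exact Finset.le_sup' (fun j => (2 : ℝ) ^ (vars j).card / ((2 : ℝ) ^ (vars j).card - s j))
      (Finset.mem_univ j)
  have hΛpos : 0 < Λmax := by
    obtain ⟨j⟩ := ‹Nonempty J›
    exact lt_of_lt_of_le (div_pos (by positivity) (hsr j).2) (hΛj j)
  have hmean : ∑ x, H x = 0 := by
    simp only [hH]
    rw [Finset.sum_comm]
    refine Finset.sum_eq_zero fun j _ => ?_
    have hle : (vars j).card ≤ n := by simpa using (vars j).card_le_univ
    have hcompl := Finset.card_filter_add_card_filter_not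
      (s := (Finset.univ : Finset (Fin n → Bool))) (fun x => sat j x = true)
    have hpow : (2 : ℝ) ^ n = 2 ^ (n - (vars j).card) * 2 ^ (vars j).card := by
      rw [← pow_add, Nat.sub_add_cancel hle]
    have hcompl' : ((Finset.univ.filter fun x : Fin n → Bool => ¬ sat j x = true).card : ℝ)
        = 2 ^ (n - (vars j).card) * (2 ^ (vars j).card - s j) := by
      rw [hcount j] at hcompl
      have h := congrArg (Nat.cast : ℕ → ℝ) hcompl
      simp only [Finset.card_univ, Fintype.card_pi, Fintype.card_bool, Finset.prod_const,
        Fintype.card_fin, Nat.cast_add, Nat.cast_mul, Nat.cast_pow, Nat.cast_ofNat] at h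
      linarith
    rw [Finset.sum_ite, Finset.sum_const, Finset.sum_const, nsmul_eq_mul, nsmul_eq_mul,
      hcompl', hcount j]
    have := (hsr j).2.ne'
    push_cast
    field_simp
    ring
  have hdiff : ∀ i x b, |H (Function.update x i b) - H x| ≤ Λmax * d i := by
    intro i x b
    rw [hH, hH, ← Finset.sum_sub_distrib, hd, Finset.mul_sum, Finset.sum_filter]
    refine (Finset.abs_sum_le_sum_abs _ _).trans (Finset.sum_le_sum fun j _ => ?_)
    by_cases hi : i ∈ vars j
    · rw [if_pos hi]
      have hwj := hw j
      obtain ⟨h1, h2⟩ := hsr j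
      have hval : w j + s j * w j / ((2 : ℝ) ^ (vars j).card - s j) ≤ Λmax * w j := by
        refine le_of_eq_of_le ?_ (mul_le_mul_of_nonneg_right (hΛj j) hwj.le)
        field_simp
        ring
      have hnn : 0 ≤ s j * w j / ((2 : ℝ) ^ (vars j).card - s j) := by positivity
      rw [abs_le]
      constructor <;> split_ifs <;> linarith
    · rw [if_neg hi, hdep j (Function.update x i b) x fun i' hi' =>
        Function.update_of_ne (ne_of_mem_of_not_mem hi' hi) _ _]
      simp
  have hd2 : 0 < ∑ i, d i ^ 2 := by
    obtain ⟨i, -, hi⟩ := Finset.exists_ne_zero_of_sum_ne_zero (hStot ▸ hSpos.ne')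
    exact Finset.sum_pos' (fun i _ => sq_nonneg _) ⟨i, Finset.mem_univ i, by positivity⟩
  have hV : ∑ i, (Λmax * d i) ^ 2 = Λmax ^ 2 * ∑ i, d i ^ 2 := by
    simp only [mul_pow, Finset.mul_sum]
  have hmain := card_le_neg_of_bounded_differences H (fun i => Λmax * d i) hdiff hmean
    (hV ▸ by positivity) (t := -((1 - η) * H xstar)) (by nlinarith)
  rw [neg_neg, hV] at hmain
  convert hmain using 1
  rw [sub_mul, one_mul, sub_eq_add_neg, Real.rpow_add two_pos, Real.rpow_natCast,
    Real.rpow_def_of_pos two_pos]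
  congr 2
  have hlog : Real.log 2 ≠ 0 := (Real.log_pos one_lt_two).ne'
  have hn' : (n : ℝ) ≠ 0 := by positivity
  rw [hγ, hD, div_pow, sq_abs]
  field_simp
end

section
/- Probabilistic core of the generic ranking-based reduction (Theorem C.1): Let Ω be a finite nonempty set, H : Ω → ℝ, τ ∈ ℝ, and let S ⊆ T ⊆ Ω satisfy S ⊆ {x ∈ Ω : H(x) ≤ τ} ⊆ T. Let s, t > 0 with |S| ≥ s and |T| ≤ t, and let δ ∈ (0,1/2). Set N = ⌈(|Ω|/s)·ln(2/δ)⌉ and K = min{N, ⌈(2/δ)·N·(t/|Ω|)⌉}. Let X_1,…,X_N be independent uniformly distributed samples from Ω. Then with probability at least 1-δ, the sample contains at least one point of S and at most K of the sampled indices i satisfy X_i ∈ T; moreover, on this event, for any sampled point x₀ ∈ S, at most K sampled points z satisfy H(z) ≤ H(x₀). -/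
theorem card_filter_apply_mem {ι Ω : Type*} [Fintype ι] [Fintype Ω]
    [DecidableEq ι] [DecidableEq Ω] [Nonempty Ω] (T : Finset Ω) (i : ι) :
    (((Finset.univ.filter fun f : ι → Ω => f i ∈ T).card : ℕ) : ℝ) =
      T.card / Fintype.card Ω * (Fintype.card Ω : ℝ) ^ Fintype.card ι := by
  have h : (Finset.univ.filter fun f : ι → Ω => f i ∈ T) =
      Fintype.piFinset fun j => if j = i then T else Finset.univ := by
    ext f
    simp only [Finset.mem_filter, Finset.mem_univ, true_and, Fintype.mem_piFinset]
    constructor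
    · intro hf j
      split_ifs with hj
      · exact hj ▸ hf
      · exact Finset.mem_univ _
    · intro hf
      simpa using hf i
  have hn : (Fintype.card Ω : ℝ) ≠ 0 := by exact_mod_cast Fintype.card_ne_zero
  have hprod : ∀ j : ι, (((if j = i then T else Finset.univ).card : ℕ) : ℝ) =
      (if j = i then (T.card : ℝ) / Fintype.card Ω else 1) * Fintype.card Ω := by
    intro j
    split_ifs
    · rw [div_mul_cancel₀ _ hn]
    · rw [one_mul, Finset.card_univ]
  rw [h, Fintype.card_piFinset, Nat.cast_prod, Finset.prod_congr rfl fun j _ => hprod j,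
    Finset.prod_mul_distrib, Finset.prod_ite_eq' Finset.univ i, if_pos (Finset.mem_univ i),
    Finset.prod_const, Finset.card_univ]

/-- Markov's inequality for the number of coordinates of a uniform random vector that lie
in `T`. -/
theorem mul_card_filter_lt_card_le {ι Ω : Type*} [Fintype ι] [Fintype Ω]
    [DecidableEq ι] [DecidableEq Ω] [Nonempty Ω] (T : Finset Ω) (K : ℕ) :
    (K : ℝ) * ((Finset.univ.filter fun f : ι → Ω =>
        K < (Finset.univ.filter fun i => f i ∈ T).card).card : ℕ) ≤
      Fintype.card ι * (T.card / Fintype.card Ω * (Fintype.card Ω : ℝ) ^ Fintype.card ι) := by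
  have hsum : (∑ f : ι → Ω, (((Finset.univ.filter fun i => f i ∈ T).card : ℕ) : ℝ)) =
      Fintype.card ι * (T.card / Fintype.card Ω * (Fintype.card Ω : ℝ) ^ Fintype.card ι) := by
    simp_rw [Finset.natCast_card_filter]
    rw [Finset.sum_comm, Finset.sum_congr rfl fun i _ =>
      (Finset.natCast_card_filter _ _).symm.trans (card_filter_apply_mem T i),
      Finset.sum_const, Finset.card_univ, nsmul_eq_mul]
  rw [← hsum, mul_comm, ← nsmul_eq_mul]
  refine (Finset.card_nsmul_le_sum _
    (fun f : ι → Ω => (((Finset.univ.filter fun i => f i ∈ T).card : ℕ) : ℝ)) _ ?_).trans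
    (Finset.sum_le_sum_of_subset_of_nonneg (Finset.subset_univ _) fun _ _ _ => Nat.cast_nonneg _)
  intro f hf
  exact_mod_cast (Finset.mem_filter.mp hf).2.le

theorem sub_pow_le_mul_pow {n a s ε : ℝ} {N : ℕ} (hn : 0 < n) (hs : 0 < s) (hsa : s ≤ a)
    (han : a ≤ n) (hε : 0 < ε) (hN : n / s * Real.log ε⁻¹ ≤ N) :
    (n - a) ^ N ≤ ε * n ^ N := by
  have h1 : n - a ≤ n * Real.exp (-(s / n)) := by
    have h := Real.add_one_le_exp (-(s / n))
    calc n - a ≤ n * (-(s / n) + 1) := by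
          rw [mul_add, mul_neg, mul_div_cancel₀ _ hn.ne']
          linarith
      _ ≤ _ := by gcongr
  have h2 : Real.log ε⁻¹ ≤ N * (s / n) := by
    have h := mul_le_mul_of_nonneg_right hN (div_pos hs hn).le
    have h' : n / s * Real.log ε⁻¹ * (s / n) = Real.log ε⁻¹ := by field_simp
    linarith
  calc (n - a) ^ N ≤ (n * Real.exp (-(s / n))) ^ N :=
        pow_le_pow_left₀ (by linarith) h1 N
    _ = Real.exp (N * -(s / n)) * n ^ N := by rw [mul_pow, ← Real.exp_nat_mul, mul_comm]
    _ ≤ Real.exp (Real.log ε) * n ^ N := by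
        rw [Real.log_inv] at h2
        gcongr
        linarith
    _ = ε * n ^ N := by rw [Real.exp_log hε]

open scoped Classical

/-- **Probabilistic core of the generic ranking-based reduction** (Theorem C.1): let `Ω`
be a finite nonempty set, `H : Ω → ℝ`, `τ ∈ ℝ`, and `S ⊆ T ⊆ Ω` with
`S ⊆ {x : H(x) ≤ τ} ⊆ T`. Let `s, t > 0` with `|S| ≥ s` and `|T| ≤ t`, `δ ∈ (0,1/2)`,
`N = ⌈(|Ω|/s)·ln(2/δ)⌉` and `K = min{N, ⌈(2/δ)·N·(t/|Ω|)⌉}`. If `X_1,…,X_N` are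
independent uniform samples from `Ω` (modelled by the uniform distribution on
`Fin N → Ω`), then with probability at least `1-δ` (i.e. for a fraction at least `1-δ`
of all sample vectors `f : Fin N → Ω`) the sample contains at least one point of `S` and
at most `K` of the sampled indices land in `T`; moreover, on this event, for any sampled
point `x₀ = f i₀ ∈ S`, at most `K` sampled points `z = f i` satisfy `H(z) ≤ H(x₀)`. -/
theorem ranking_based_reduction_core {Ω : Type*} [Fintype Ω] [Nonempty Ω] [DecidableEq Ω]
    (H : Ω → ℝ) (τ : ℝ) (S T : Finset Ω)
    (hSτ : ∀ x ∈ S, H x ≤ τ) (hτT : ∀ x : Ω, H x ≤ τ → x ∈ T)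
    (s t : ℝ) (hs : 0 < s) (ht : 0 < t)
    (hScard : s ≤ (S.card : ℝ)) (hTcard : (T.card : ℝ) ≤ t)
    (δ : ℝ) (hδ0 : 0 < δ) (hδ1 : δ < 1 / 2)
    (N K : ℕ)
    (hN : N = ⌈((Fintype.card Ω : ℝ) / s) * Real.log (2 / δ)⌉₊)
    (hK : K = min N ⌈(2 / δ) * (N : ℝ) * (t / (Fintype.card Ω : ℝ))⌉₊)
    (E : Finset (Fin N → Ω))
    (hE : E = Finset.univ.filter fun f : Fin N → Ω =>
      (∃ i, f i ∈ S) ∧ (Finset.univ.filter fun i => f i ∈ T).card ≤ K) :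
    (1 - δ) * ((Fintype.card Ω : ℝ) ^ N) ≤ (E.card : ℝ) ∧
      ∀ f ∈ E, ∀ i₀ : Fin N, f i₀ ∈ S →
        (Finset.univ.filter fun i => H (f i) ≤ H (f i₀)).card ≤ K := by
  subst hE
  have hn : (0 : ℝ) < Fintype.card Ω := by exact_mod_cast Fintype.card_pos
  constructor
  · have hmiss : (((Fintype.piFinset fun _ : Fin N => Sᶜ).card : ℕ) : ℝ) ≤
        δ / 2 * (Fintype.card Ω : ℝ) ^ N := by
      rw [Fintype.card_piFinset, Finset.prod_const, Finset.card_univ, Fintype.card_fin,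
        Finset.card_compl, Nat.cast_pow, Nat.cast_sub (Finset.card_le_univ S)]
      refine sub_pow_le_mul_pow hn hs hScard (by exact_mod_cast Finset.card_le_univ S)
        (half_pos hδ0) ?_
      rw [inv_div, hN]
      exact Nat.le_ceil _
    have hmany : (((Finset.univ.filter fun f : Fin N → Ω =>
        K < (Finset.univ.filter fun i => f i ∈ T).card).card : ℕ) : ℝ) ≤
        δ / 2 * (Fintype.card Ω : ℝ) ^ N := by
      rcases min_choice N ⌈(2 / δ) * (N : ℝ) * (t / (Fintype.card Ω : ℝ))⌉₊ with h | h
      · rw [Finset.filter_false_of_mem, Finset.card_empty, Nat.cast_zero]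
        · positivity
        · intro f _
          rw [not_lt, hK, h]
          exact (Finset.card_le_univ _).trans (Fintype.card_fin N).le
      · have hNpos : (0 : ℝ) < N := by
          have hlog : 0 < Real.log (2 / δ) :=
            Real.log_pos ((one_lt_div hδ0).mpr (by linarith))
          rw [hN]
          exact_mod_cast Nat.ceil_pos.mpr (mul_pos (div_pos hn hs) hlog)
        have hKge : (2 / δ) * (N : ℝ) * (t / (Fintype.card Ω : ℝ)) ≤ K := by
          rw [hK, h]
          exact Nat.le_ceil _
        have hmarkov := mul_card_filter_lt_card_le (ι := Fin N) T K
        rw [Fintype.card_fin] at hmarkov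
        set B : ℝ := (((Finset.univ.filter fun f : Fin N → Ω =>
          K < (Finset.univ.filter fun i => f i ∈ T).card).card : ℕ) : ℝ)
        have hB0 : 0 ≤ B := Nat.cast_nonneg _
        have hpos : 0 < (2 / δ) * (N : ℝ) * (t / (Fintype.card Ω : ℝ)) := by positivity
        refine le_of_mul_le_mul_left ?_ hpos
        calc (2 / δ) * (N : ℝ) * (t / (Fintype.card Ω : ℝ)) * B ≤ K * B := by gcongr
          _ ≤ N * (T.card / Fintype.card Ω * (Fintype.card Ω : ℝ) ^ N) := hmarkov
          _ ≤ N * (t / Fintype.card Ω * (Fintype.card Ω : ℝ) ^ N) := by gcongr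
          _ = _ := by field_simp
    set E := Finset.univ.filter fun f : Fin N → Ω =>
      (∃ i, f i ∈ S) ∧ (Finset.univ.filter fun i => f i ∈ T).card ≤ K
    set A := Fintype.piFinset fun _ : Fin N => Sᶜ
    set B := Finset.univ.filter fun f : Fin N → Ω =>
      K < (Finset.univ.filter fun i => f i ∈ T).card
    have hcover : (Finset.univ : Finset (Fin N → Ω)) ⊆ E ∪ (A ∪ B) := by
      intro f _
      by_cases hf : ∃ i, f i ∈ S
      · rcases le_or_gt (Finset.univ.filter fun i => f i ∈ T).card K with hc | hc
        · exact Finset.mem_union_left _ (Finset.mem_filter.mpr ⟨Finset.mem_univ _, hf, hc⟩)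
        · exact Finset.mem_union_right _ (Finset.mem_union_right _
            (Finset.mem_filter.mpr ⟨Finset.mem_univ _, hc⟩))
      · exact Finset.mem_union_right _ (Finset.mem_union_left _
          (Fintype.mem_piFinset.mpr fun i => Finset.mem_compl.mpr (not_exists.mp hf i)))
    have hcard : Fintype.card Ω ^ N ≤ E.card + (A.card + B.card) := by
      calc Fintype.card Ω ^ N = (Finset.univ : Finset (Fin N → Ω)).card := by simp
        _ ≤ (E ∪ (A ∪ B)).card := Finset.card_le_card hcover
        _ ≤ E.card + (A ∪ B).card := Finset.card_union_le _ _
        _ ≤ _ := Nat.add_le_add_left (Finset.card_union_le _ _) _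
    have hcard' : (Fintype.card Ω : ℝ) ^ N ≤ E.card + (A.card + B.card) := by
      exact_mod_cast hcard
    linarith
  · intro f hf i₀ hi₀
    refine le_trans (Finset.card_le_card fun i hi => ?_) (Finset.mem_filter.mp hf).2.2
    rw [Finset.mem_filter] at hi ⊢
    exact ⟨hi.1, hτT _ (hi.2.trans (hSτ _ hi₀))⟩
end
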